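/- For transmission of a binary linear code over a binary memoryless symmetric channel, and for any vector m = (m_{−M+1},…,m_M) of nonnegative integers satisfying m_j ≥ n·ε_{j|0} and m_j ≤ n for all j = −M+1,…,M, the maximum-likelihood decoding error probability satisfies P_e ≤ Σ_{ℓ ∈ Ũ_n(m)} (∏_{j=−M}^{M} ε_{j|0}^{ℓ_j}) Σ_{w=d_min}^{n} S_w Σ_{μ} (w choose μ_{−M},…,μ_M)(n−w choose ℓ_{−M}−μ_{−M},…,ℓ_M−μ_M) + Σ_{j=−M+1}^{M} exp(−n·D(m_j/n ∥ ε_{j|0})), where Ũ_n(m) = { ℓ ∈ Z_{≥0}^{2M+1} : Σ_j ℓ_j = n and ℓ_j ≤ m_j for all j = −M+1,…,M }, the inner sum over μ ranges over all vectors μ of nonnegative integers with Σ_j μ_j = w, μ_j ≤ ℓ_j for every j, and ∏_j ε_{j|0}^{μ_j} ≤ ∏_j ε_{j|1}^{μ_j}, and D(a∥p) = a·log(a/p) + (1−a)·log((1−a)/(1−p)) is the binary Kullback–Leibler divergence. -/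

import Mathlib

/-!
The rectangular-type-search Poltyrev bound for BMS channels, with the
large-noise region bounded via the Chernoff bound (binary KL divergence).
-/

open Finset

open scoped Classical

noncomputable section

/-- The output alphabet `𝒴 = {-M, …, -1, 0, 1, …, M}` of a BMS channel. -/
abbrev outAlphabet (M : ℕ) : Type := ↥(Finset.Icc (-(M : ℤ)) (M : ℤ))

/-- Binary Kullback–Leibler divergence
`D(a ‖ p) = a log(a/p) + (1-a) log((1-a)/(1-p))` between Bernoulli(a) and
Bernoulli(p) (with the junk-value conventions of `Real.log` and real division,
under which `0 · log(0/q) = 0`). -/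
def klBin (a p : ℝ) : ℝ :=
  a * Real.log (a / p) + (1 - a) * Real.log ((1 - a) / (1 - p))

/-- The type (composition) of a word `y`: the number of occurrences of each letter. -/
def wordType {ι α : Type*} [Fintype ι] [DecidableEq α] (y : ι → α) (a : α) : ℕ :=
  #{i | y i = a}

lemma wordType_le {ι α : Type*} [Fintype ι] [DecidableEq α] (y : ι → α) (a : α) :
    wordType y a ≤ Fintype.card ι :=
  card_le_univ _

lemma sum_wordType {ι α : Type*} [Fintype ι] [Fintype α] [DecidableEq α] (y : ι → α) :
    ∑ a, wordType y a = Fintype.card ι :=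
  (card_eq_sum_card_fiberwise (s := univ) (f := y) (t := univ) fun _ _ => mem_univ _).symm

lemma prod_eq_prod_pow_wordType {ι α R : Type*} [Fintype ι] [Fintype α] [DecidableEq α]
    [CommMonoid R] (p : α → R) (y : ι → α) :
    ∏ i, p (y i) = ∏ a, p a ^ wordType y a := by
  simp only [wordType, ← prod_const]
  exact (prod_fiberwise' univ y p).symm

/-- The number of words of a given type is at most (in fact equal to) a multinomial coefficient. -/
lemma card_wordType_eq_le {ι α : Type*} [Fintype ι] [DecidableEq ι] [Fintype α] [DecidableEq α]
    (k : α → ℕ) :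
    #{y : ι → α | wordType y = k} ≤ Nat.multinomial univ k := by
  by_cases hk : ∑ a, k a = Fintype.card ι
  · have h1 : (∑ a, (MvPolynomial.X a : MvPolynomial α ℕ)) ^ Fintype.card ι =
        ∑ y : ι → α, MvPolynomial.monomial (Finsupp.equivFunOnFinite.symm (wordType y)) 1 := by
      rw [← Finset.card_univ, ← prod_const, Fintype.prod_sum]
      refine sum_congr rfl fun y _ => ?_
      rw [prod_eq_prod_pow_wordType (fun a => (MvPolynomial.X a : MvPolynomial α ℕ)),
        MvPolynomial.monomial_eq, Finsupp.prod_fintype _ _ (by simp)]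
      simp
    have h2 := congrArg (MvPolynomial.coeff (Finsupp.equivFunOnFinite.symm k)) h1
    rw [sum_pow_eq_sum_piAntidiag, MvPolynomial.coeff_sum, MvPolynomial.coeff_sum] at h2
    have h3 : ∀ y : ι → α, MvPolynomial.coeff (Finsupp.equivFunOnFinite.symm k)
        (MvPolynomial.monomial (Finsupp.equivFunOnFinite.symm (wordType y)) (1 : ℕ)) =
        if wordType y = k then 1 else 0 := by
      intro y
      rw [MvPolynomial.coeff_monomial]
      simp only [Equiv.apply_eq_iff_eq]
    have h4 : ∀ l : α → ℕ, MvPolynomial.coeff (Finsupp.equivFunOnFinite.symm k)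
        ((Nat.multinomial univ l : MvPolynomial α ℕ) * ∏ a, MvPolynomial.X a ^ l a) =
        if l = k then Nat.multinomial univ k else 0 := by
      intro l
      have : (∏ a, MvPolynomial.X a ^ l a : MvPolynomial α ℕ) =
          MvPolynomial.monomial (Finsupp.equivFunOnFinite.symm l) 1 := by
        rw [MvPolynomial.monomial_eq, Finsupp.prod_fintype _ _ (by simp)]
        simp
      rw [this, ← map_natCast (MvPolynomial.C : ℕ →+* MvPolynomial α ℕ),
        MvPolynomial.coeff_C_mul, MvPolynomial.coeff_monomial]
      simp only [Equiv.apply_eq_iff_eq]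
      split_ifs with h <;> simp [h]
    simp only [h3, h4] at h2
    rw [card_filter, ← h2, sum_ite_eq', if_pos (by simp [hk])]
  · rw [filter_eq_empty_iff.2]
    · simp
    · rintro y - rfl
      exact hk (sum_wordType y)

/-- Words of type `l` whose restriction to the support of `c` has type `k`. -/
lemma card_wordType_restrict_le {ι α : Type*} [Fintype ι] [DecidableEq ι] [Fintype α]
    [DecidableEq α] (c : ι → Bool) (l k : α → ℕ) :
    #{y : ι → α | wordType y = l ∧ wordType (fun i : {i // c i = true} => y i) = k} ≤
      Nat.multinomial univ k * Nat.multinomial univ (fun a => l a - k a) := by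
  have hsplit : ∀ (y : ι → α) a, wordType y a =
      wordType (fun i : {i // c i = true} => y i) a +
        wordType (fun i : {i // ¬ c i = true} => y i) a := by
    intro y a
    simp only [wordType, card_filter]
    exact (Fintype.sum_subtype_add_sum_subtype (fun i => c i = true)
      (fun i => if y i = a then 1 else 0)).symm
  refine le_trans ?_ (Nat.mul_le_mul (card_wordType_eq_le (ι := {i // c i = true}) k)
    (card_wordType_eq_le (ι := {i // ¬ c i = true}) (fun a => l a - k a)))
  rw [← card_product]
  refine card_le_card_of_injOn (Equiv.piEquivPiSubtypeProd (fun i => c i = true) fun _ => α) ?_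
    (Equiv.injective _).injOn
  intro y hy
  simp only [coe_filter, mem_univ, true_and, Set.mem_ofPred_eq] at hy
  simp only [coe_product, coe_filter, mem_univ, true_and, Set.mem_prod, Set.mem_ofPred_eq,
    Equiv.piEquivPiSubtypeProd_apply]
  refine ⟨hy.2, funext fun a => ?_⟩
  have := hsplit y a
  rw [hy.1, hy.2] at this
  omega

/-- For a codeword `c`, the number of words of type `l` for which `c` is at least as likely as
zero, bounded by a sum over the possible types on the support of `c`. -/
lemma card_pairwise_error_le {n : ℕ} {α : Type*} [Fintype α] [DecidableEq α]
    (p q : α → ℝ) (c : Fin n → Bool) (l : α → ℕ) :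
    #{y : Fin n → α | wordType y = l ∧
        ∏ i : {i // c i = true}, p (y i) ≤ ∏ i : {i // c i = true}, q (y i)} ≤
      ∑ k : α → Fin (n + 1) with ∑ a, (k a : ℕ) = #{i | c i = true} ∧
          (∀ a, (k a : ℕ) ≤ l a) ∧ ∏ a, p a ^ (k a : ℕ) ≤ ∏ a, q a ^ (k a : ℕ),
        Nat.multinomial univ (fun a => (k a : ℕ)) *
          Nat.multinomial univ (fun a => l a - (k a : ℕ)) := by
  have hcard : Fintype.card {i // c i = true} = #{i | c i = true} := Fintype.card_subtype _
  have hlt : ∀ (y : Fin n → α) a,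
      wordType (fun i : {i // c i = true} => y i) a < n + 1 := fun y a =>
    Nat.lt_succ_of_le ((wordType_le _ a).trans
      ((Fintype.card_subtype_le _).trans (Fintype.card_fin n).le))
  let T : (Fin n → α) → α → Fin (n + 1) := fun y a => ⟨_, hlt y a⟩
  rw [card_eq_sum_card_fiberwise (f := T) (t := {k : α → Fin (n + 1) |
      ∑ a, (k a : ℕ) = #{i | c i = true} ∧
        (∀ a, (k a : ℕ) ≤ l a) ∧ ∏ a, p a ^ (k a : ℕ) ≤ ∏ a, q a ^ (k a : ℕ)})]
  · refine sum_le_sum fun k _ => le_trans (card_le_card ?_) (card_wordType_restrict_le c l _)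
    intro y hy
    simp only [mem_filter, mem_univ, true_and] at hy ⊢
    refine ⟨hy.1.1, funext fun a => ?_⟩
    rw [← hy.2]
  · intro y hy
    simp only [coe_filter, mem_univ, true_and, Set.mem_ofPred_eq] at hy ⊢
    refine ⟨(sum_wordType _).trans hcard, fun a => ?_, ?_⟩
    · rw [← hy.1]
      simp only [T, wordType]
      refine card_le_card_of_injOn Subtype.val (fun i hi => ?_) Subtype.val_injective.injOn
      exact mem_filter.2 ⟨mem_univ _, (mem_filter.1 hi).2⟩
    · have h := hy.2
      rwa [prod_eq_prod_pow_wordType p (fun i : {i // c i = true} => y i),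
        prod_eq_prod_pow_wordType q (fun i : {i // c i = true} => y i)] at h

/-- Markov's inequality for the exponential moment of the number of occurrences of a letter. -/
lemma sum_wordType_tail_le_moment {n : ℕ} {α : Type*} [Fintype α] [DecidableEq α]
    (p : α → ℝ) (hp : ∀ a, 0 ≤ p a) (hsum : ∑ a, p a = 1) (j : α) (m : ℕ) {t : ℝ} (ht : 1 ≤ t) :
    ∑ y : Fin n → α, (∏ i, p (y i)) * (if m ≤ wordType y j then 1 else 0) ≤
      (1 - p j + p j * t) ^ n / t ^ m := by
  have ht0 : 0 < t := one_pos.trans_le ht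
  have hexp : (1 - p j + p j * t) ^ n =
      ∑ y : Fin n → α, (∏ i, p (y i)) * t ^ wordType y j := by
    have h1 : 1 - p j + p j * t = ∑ a, p a * (if a = j then t else 1) := by
      have : ∀ a, p a * (if a = j then t else 1) = p a + if a = j then p j * (t - 1) else 0 := by
        intro a
        split_ifs with h
        · rw [h]; ring
        · ring
      simp only [this, sum_add_distrib, hsum, sum_ite_eq', mem_univ, if_true]
      ring
    rw [h1, ← Fin.prod_const, Fintype.prod_sum]
    refine sum_congr rfl fun y _ => ?_
    rw [prod_mul_distrib, wordType, ← prod_const, prod_filter]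
  rw [hexp, sum_div]
  refine sum_le_sum fun y _ => ?_
  rw [mul_div_assoc]
  refine mul_le_mul_of_nonneg_left ?_ (prod_nonneg fun i _ => hp _)
  split_ifs with h
  · rw [le_div_iff₀ (pow_pos ht0 _), one_mul]
    exact pow_le_pow_right₀ ht h
  · positivity

/-- The Chernoff bound for the number of occurrences of a letter. -/
lemma sum_wordType_tail_le_exp_klBin {n : ℕ} {α : Type*} [Fintype α] [DecidableEq α]
    (p : α → ℝ) (hp : ∀ a, 0 ≤ p a) (hsum : ∑ a, p a = 1) (j : α) (m : ℕ)
    (hm : (n : ℝ) * p j ≤ m) :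
    ∑ y : Fin n → α, (∏ i, p (y i)) * (if m < wordType y j then 1 else 0) ≤
      Real.exp (-(n : ℝ) * klBin ((m : ℝ) / (n : ℝ)) (p j)) := by
  rcases le_or_gt n m with hnm | hmn
  · rw [sum_eq_zero]
    · positivity
    · intro y _
      have := wordType_le y j
      rw [Fintype.card_fin] at this
      rw [if_neg (by omega), mul_zero]
  rcases (hp j).eq_or_lt with h0 | h0
  · rw [sum_eq_zero]
    · positivity
    · intro y _
      split_ifs with h
      · obtain ⟨i, hi⟩ := card_pos.1 ((Nat.zero_le m).trans_lt h)
        rw [mem_filter] at hi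
        rw [prod_eq_zero (mem_univ i) (by rw [hi.2, ← h0]), zero_mul]
      · rw [mul_zero]
  have hn0 : (0 : ℝ) < n := by exact_mod_cast (Nat.zero_le m).trans_lt hmn
  have hm0 : (0 : ℝ) < m := (mul_pos hn0 h0).trans_le hm
  have hmn' : (m : ℝ) < n := by exact_mod_cast hmn
  set x : ℝ := (m : ℝ) / n with hx
  have hx0 : 0 < x := div_pos hm0 hn0
  have hx1 : x < 1 := (div_lt_one hn0).2 hmn'
  have hpx : p j ≤ x := by rw [hx, le_div_iff₀ hn0]; linarith
  have hp1 : 0 < 1 - p j := by linarith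
  have hx1' : 0 < 1 - x := by linarith
  have hmx : (m : ℝ) = n * x := by rw [hx]; field_simp
  set t : ℝ := x * (1 - p j) / (p j * (1 - x)) with ht
  have ht1 : 1 ≤ t := by
    rw [ht, le_div_iff₀ (by positivity)]
    nlinarith
  have ht0 : 0 < t := one_pos.trans_le ht1
  have hb : 1 - p j + p j * t = (1 - p j) / (1 - x) := by
    rw [ht]; field_simp; ring
  refine le_trans ?_ ((sum_wordType_tail_le_moment (n := n) p hp hsum j m ht1).trans_eq ?_)
  · refine sum_le_sum fun y _ => mul_le_mul_of_nonneg_left ?_ (prod_nonneg fun i _ => hp _)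
    split_ifs <;> first | omega | norm_num
  · have hlogt : Real.log t = Real.log x + Real.log (1 - p j) -
        (Real.log (p j) + Real.log (1 - x)) := by
      rw [ht, Real.log_div (by positivity) (by positivity), Real.log_mul hx0.ne' hp1.ne',
        Real.log_mul h0.ne' hx1'.ne']
    rw [hb, ← Real.exp_log (show 0 < ((1 - p j) / (1 - x)) ^ n / t ^ m by positivity),
      Real.log_div (by positivity) (by positivity), Real.log_pow, Real.log_pow, hlogt, klBin,
      Real.log_div hp1.ne' hx1'.ne', Real.log_div hx0.ne' h0.ne',
      Real.log_div hx1'.ne' hp1.ne', hmx]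
    congr 1
    ring

/-- Off the zero-probability words, comparing likelihoods amounts to comparing them on the
support of the codeword. -/
lemma prod_support_le_of_prod_le {ι : Type*} [Fintype ι] (c : ι → Bool) (f : ι → Bool → ℝ)
    (hf : ∀ i x, 0 ≤ f i x) (hpos : ∏ i, f i false ≠ 0)
    (h : ∏ i, f i false ≤ ∏ i, f i (c i)) :
    ∏ i : {i // c i = true}, f i false ≤ ∏ i : {i // c i = true}, f i true := by
  have hs : ∀ g : ι → ℝ, ∏ i, g i =
      (∏ i : {i // c i = true}, g i) * ∏ i : {i // ¬ c i = true}, g i := fun g =>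
    (Fintype.prod_subtype_mul_prod_subtype (fun i => c i = true) g).symm
  rw [hs] at hpos
  rw [hs, hs (fun i => f i (c i))] at h
  have h1 : ∏ i : {i // c i = true}, f i (c i) = ∏ i : {i // c i = true}, f i true :=
    prod_congr rfl fun i _ => by rw [i.2]
  have h2 : ∏ i : {i // ¬ c i = true}, f i (c i) = ∏ i : {i // ¬ c i = true}, f i false :=
    prod_congr rfl fun i _ => by rw [Bool.eq_false_of_not_eq_true i.2]
  rw [h1, h2] at h
  exact le_of_mul_le_mul_right h
    ((prod_nonneg fun i _ => hf _ _).lt_of_ne' (right_ne_zero_of_mul hpos))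

/-- **Rectangular-type-search Poltyrev bound with Chernoff tail for a BMS
channel.**  The setting is as in the extended Poltyrev bound: BMS channel with
output alphabet `{-M, …, M}`, transition probabilities `ε`, binary linear code
`C` with weight distribution `S` and minimum distance `dmin`; the all-zero
codeword is transmitted and `Pe` is the ML (worst-case tie-breaking) error
probability.  For any nonnegative integers `m_j`, `j = -M+1, …, M`, with
`n · ε_{j|0} ≤ m_j ≤ n`, the union bound is applied on the rectangular set
`Ũ_n(m)` and the large-noise region is bounded by
`Σ_{j=-M+1}^{M} exp(-n D(m_j/n ‖ ε_{j|0}))`. -/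
theorem poltyrev_bound_BMS_rect_chernoff
    (M n : ℕ) (ε : ℤ → Bool → ℝ)
    (hnn : ∀ y x, 0 ≤ ε y x)
    (hsum : ∀ x, ∑ y ∈ Finset.Icc (-(M : ℤ)) (M : ℤ), ε y x = 1)
    (hsym : ∀ y ∈ Finset.Icc (-(M : ℤ)) (M : ℤ), ε y true = ε (-y) false)
    (C : Finset (Fin n → Bool))
    (hzero : (fun _ => false) ∈ C)
    (hlin : ∀ c ∈ C, ∀ c' ∈ C, (fun i => Bool.xor (c i) (c' i)) ∈ C)
    (S : ℕ → ℕ)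
    (hS : ∀ w, S w =
      (C.filter (fun c => (univ.filter (fun i => c i = true)).card = w)).card)
    (dmin : ℕ)
    (hdmin : IsLeast {w | ∃ c ∈ C, c ≠ (fun _ => false) ∧
      (univ.filter (fun i => c i = true)).card = w} dmin)
    (m : ℤ → ℕ)
    (hm : ∀ j ∈ Finset.Icc (-(M : ℤ) + 1) (M : ℤ),
      (n : ℝ) * ε j false ≤ (m j : ℝ) ∧ m j ≤ n)
    (Pe : ℝ)
    (hPe : Pe = ∑ y : Fin n → outAlphabet M,
      (∏ i, ε (y i : ℤ) false) *
        (if ∃ c ∈ C, c ≠ (fun _ => false) ∧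
            (∏ i, ε (y i : ℤ) false) ≤ ∏ i, ε (y i : ℤ) (c i)
         then 1 else 0)) :
    Pe ≤
      (∑ ℓ ∈ (univ : Finset (outAlphabet M → Fin (n + 1))).filter
          (fun ℓ => ∑ j, (ℓ j : ℕ) = n ∧
            ∀ j : outAlphabet M, (j : ℤ) ≠ -(M : ℤ) → (ℓ j : ℕ) ≤ m (j : ℤ)),
        (∏ j : outAlphabet M, ε (j : ℤ) false ^ (ℓ j : ℕ)) *
          ∑ w ∈ Finset.Icc dmin n, (S w : ℝ) *
            ∑ μ ∈ (univ : Finset (outAlphabet M → Fin (n + 1))).filter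
                (fun μ => (∑ j, (μ j : ℕ) = w) ∧ (∀ j, (μ j : ℕ) ≤ (ℓ j : ℕ)) ∧
                  (∏ j : outAlphabet M, ε (j : ℤ) false ^ (μ j : ℕ)) ≤
                    ∏ j : outAlphabet M, ε (j : ℤ) true ^ (μ j : ℕ)),
              ((Nat.multinomial univ (fun j => (μ j : ℕ))) : ℝ) *
                ((Nat.multinomial univ (fun j => (ℓ j : ℕ) - (μ j : ℕ))) : ℝ)) +
      ∑ j ∈ Finset.Icc (-(M : ℤ) + 1) (M : ℤ),
        Real.exp (-(n : ℝ) * klBin ((m j : ℝ) / (n : ℝ)) (ε j false)) := by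
  have hsum' : ∑ a : outAlphabet M, ε (a : ℤ) false = 1 := by
    rw [← hsum false]
    exact sum_coe_sort (Finset.Icc (-(M : ℤ)) (M : ℤ)) (fun y => ε y false)
  set P : (Fin n → outAlphabet M) → ℝ := fun y => ∏ i, ε (y i : ℤ) false with hP
  have hP0 : ∀ y, 0 ≤ P y := fun y => prod_nonneg fun i _ => hnn _ _
  set E : (Fin n → outAlphabet M) → Prop := fun y => ∃ c ∈ C, c ≠ (fun _ => false) ∧
    P y ≤ ∏ i, ε (y i : ℤ) (c i) with hE
  let T : (Fin n → outAlphabet M) → outAlphabet M → Fin (n + 1) := fun y a =>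
    ⟨wordType y a, Nat.lt_succ_of_le ((wordType_le y a).trans (Fintype.card_fin n).le)⟩
  set U : Finset (outAlphabet M → Fin (n + 1)) := univ.filter (fun ℓ => ∑ j, (ℓ j : ℕ) = n ∧
    ∀ j : outAlphabet M, (j : ℤ) ≠ -(M : ℤ) → (ℓ j : ℕ) ≤ m (j : ℤ)) with hU
  set N : ℤ → (Fin n → outAlphabet M) → ℕ := fun j y => #{i | (y i : ℤ) = j} with hN
  have hsplit : Pe ≤ ∑ y with T y ∈ U, P y * (if E y then 1 else 0) +
      ∑ j ∈ Finset.Icc (-(M : ℤ) + 1) (M : ℤ), ∑ y, P y * (if m j < N j y then 1 else 0) := by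
    rw [hPe, sum_comm, sum_filter, ← sum_add_distrib]
    refine sum_le_sum fun y _ => ?_
    have hterm : ∀ j ∈ Finset.Icc (-(M : ℤ) + 1) (M : ℤ),
        0 ≤ P y * (if m j < N j y then (1 : ℝ) else 0) := fun j _ =>
      mul_nonneg (hP0 y) (by split_ifs <;> norm_num)
    by_cases hy : T y ∈ U
    · rw [if_pos hy]
      exact le_add_of_nonneg_right (sum_nonneg hterm)
    · rw [if_neg hy, zero_add]
      obtain ⟨j, hj, hlt⟩ : ∃ j : outAlphabet M, (j : ℤ) ≠ -(M : ℤ) ∧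
          m (j : ℤ) < wordType y j := by
        by_contra! hcon
        refine hy (mem_filter.2 ⟨mem_univ _, ?_, hcon⟩)
        exact (sum_wordType y).trans (Fintype.card_fin n)
      have hjmem : (j : ℤ) ∈ Finset.Icc (-(M : ℤ) + 1) (M : ℤ) := by
        have := Finset.mem_Icc.1 j.2
        rw [Finset.mem_Icc]
        omega
      have hNj : N j y = wordType y j := by
        simp only [hN, wordType, Subtype.ext_iff]
      refine le_trans ?_ (single_le_sum hterm hjmem)
      rw [hNj, if_pos hlt]
      refine mul_le_mul_of_nonneg_left ?_ (hP0 y)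
      split_ifs <;> norm_num
  refine hsplit.trans (add_le_add ?_ ?_)
  · rw [← sum_fiberwise_of_maps_to (g := T) (t := U) (fun y hy => (mem_filter.1 hy).2)]
    refine sum_le_sum fun ℓ hℓ => ?_
    set Q : ℝ := ∏ j : outAlphabet M, ε (j : ℤ) false ^ (ℓ j : ℕ) with hQ
    have hQ0 : 0 ≤ Q := prod_nonneg fun j _ => pow_nonneg (hnn _ _) _
    have hT : ∀ y, T y = ℓ → wordType y = fun a => (ℓ a : ℕ) := fun y hy =>
      funext fun a => by rw [← hy]
    have hPQ : ∀ y, T y = ℓ → P y = Q := fun y hy => by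
      simp only [hP, hQ]
      rw [prod_eq_prod_pow_wordType (fun a : outAlphabet M => ε (a : ℤ) false), hT y hy]
    set G : ℕ → ℕ := fun w => ∑ μ ∈ (univ : Finset (outAlphabet M → Fin (n + 1))).filter
        (fun μ => (∑ j, (μ j : ℕ) = w) ∧ (∀ j, (μ j : ℕ) ≤ (ℓ j : ℕ)) ∧
          (∏ j : outAlphabet M, ε (j : ℤ) false ^ (μ j : ℕ)) ≤
            ∏ j : outAlphabet M, ε (j : ℤ) true ^ (μ j : ℕ)),
        Nat.multinomial univ (fun j => (μ j : ℕ)) *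
          Nat.multinomial univ (fun j => (ℓ j : ℕ) - (μ j : ℕ)) with hG
    set C' := C.filter (fun c => c ≠ fun _ => false) with hC'
    let F : (Fin n → Bool) → (Fin n → outAlphabet M) → Prop := fun c y =>
      ∏ i : {i // c i = true}, ε (y i : ℤ) false ≤ ∏ i : {i // c i = true}, ε (y i : ℤ) true
    have hunion : ∀ y, T y = ℓ →
        P y * (if E y then 1 else 0) ≤ Q * ∑ c ∈ C', if F c y then (1 : ℝ) else 0 := by
      intro y hy
      have hnonneg : ∀ c ∈ C', (0 : ℝ) ≤ if F c y then (1 : ℝ) else 0 := fun c _ => by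
        split_ifs <;> norm_num
      rw [← hPQ y hy]
      by_cases h0 : P y = 0
      · simp [h0]
      refine mul_le_mul_of_nonneg_left ?_ (hP0 y)
      split_ifs with hEy
      · obtain ⟨c, hc, hc0, hle⟩ := hEy
        refine le_trans ?_ (single_le_sum hnonneg (mem_filter.2 ⟨hc, hc0⟩))
        rw [if_pos]
        exact prod_support_le_of_prod_le c (fun i x => ε (y i : ℤ) x) (fun i x => hnn _ _) h0 hle
      · exact sum_nonneg hnonneg
    have hweight : ∑ c ∈ C', G #{i | c i = true} ≤ ∑ w ∈ Finset.Icc dmin n, S w * G w := by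
      rw [← sum_fiberwise_of_maps_to (s := C') (t := Finset.Icc dmin n)
        (g := fun c => #{i | c i = true})]
      · refine sum_le_sum fun w _ => ?_
        rw [sum_congr rfl (g := fun _ => G w) fun c hc => by rw [(mem_filter.1 hc).2],
          sum_const, smul_eq_mul, hS]
        exact Nat.mul_le_mul_right _
          (card_le_card (filter_subset_filter _ (filter_subset _ _)))
      · intro c hc
        rw [mem_filter] at hc
        exact Finset.mem_Icc.2 ⟨hdmin.2 ⟨c, hc.1, hc.2, rfl⟩,
          (card_le_univ _).trans (Fintype.card_fin n).le⟩
    calc ∑ y ∈ ({y | T y ∈ U} : Finset (Fin n → outAlphabet M)) with T y = ℓ,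
          P y * (if E y then 1 else 0)
        ≤ ∑ y with T y = ℓ, Q * ∑ c ∈ C', if F c y then (1 : ℝ) else 0 := by
          refine (sum_le_sum fun y hy => hunion y (mem_filter.1 hy).2).trans
            (sum_le_sum_of_subset_of_nonneg (filter_subset_filter _ (filter_subset _ _)) ?_)
          intro y _ _
          exact mul_nonneg hQ0 (sum_nonneg fun c _ => by split_ifs <;> norm_num)
      _ = Q * ((∑ c ∈ C', #{y | T y = ℓ ∧ F c y} : ℕ) : ℝ) := by
          rw [← mul_sum, sum_comm]
          simp only [Nat.cast_sum, ← filter_filter, sum_boole]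
      _ ≤ Q * ((∑ w ∈ Finset.Icc dmin n, S w * G w : ℕ) : ℝ) := by
          refine mul_le_mul_of_nonneg_left (Nat.cast_le.2 (le_trans ?_ hweight)) hQ0
          refine sum_le_sum fun c _ => le_trans (card_le_card ?_)
            (card_pairwise_error_le (fun a : outAlphabet M => ε (a : ℤ) false)
              (fun a : outAlphabet M => ε (a : ℤ) true) c (fun a => (ℓ a : ℕ)))
          intro y hy
          simp only [mem_filter, mem_univ, true_and] at hy ⊢
          exact ⟨hT y hy.1, hy.2⟩
      _ = _ := by
          simp only [hG]
          push_cast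
          rfl
  · refine sum_le_sum fun j hj => ?_
    have hjmem : j ∈ Finset.Icc (-(M : ℤ)) (M : ℤ) := by
      rw [Finset.mem_Icc] at hj ⊢
      omega
    have hmain := sum_wordType_tail_le_exp_klBin (n := n)
      (fun a : outAlphabet M => ε (a : ℤ) false) (fun a => hnn _ _) hsum' ⟨j, hjmem⟩ (m j)
      (hm j hj).1
    have hNj : ∀ y, N j y = wordType y ⟨j, hjmem⟩ := fun y => by
      simp only [hN, wordType, Subtype.ext_iff]
    simpa only [hNj] using hmain

end
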